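/- arXiv:1810.06382 — 2 statements merged into one kernel-verified Lean document; each statement's English description precedes it below -/
import Mathlib

section
/- Let G = (V, E) be an infinite, connected, locally finite graph, and let X ∈ V^ℕ be a lazy random walk on G started at some vertex v. Then G is Liouville (i.e., admits no non-constant bounded harmonic functions) if and only if X is tail-trivial as a V^ℕ-valued random variable. -/
open MeasureTheory Filter Classical

open scoped Classical

/-- The sub-σ-algebra of the product σ-algebra on `I → Ω` consisting of events depending
only on the coordinates in `J`. -/
def cylAlg (Ω : Type*) [m : MeasurableSpace Ω] {I : Type*} (J : Set I) :
    MeasurableSpace (I → Ω) :=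
  ⨆ i ∈ J, MeasurableSpace.comap (fun f => f i) m

/-- The tail σ-algebra of `I → Ω`: the intersection of the σ-algebras `cylAlg Ω J`
over all `J ⊆ I` with finite complement. -/
def tailAlg (Ω : Type*) [MeasurableSpace Ω] (I : Type*) : MeasurableSpace (I → Ω) :=
  ⨅ (J : Set I) (_ : Jᶜ.Finite), cylAlg Ω J

/-- One-step transition probabilities of the lazy random walk on `G`: stay put with
probability `1/2`, otherwise move to a uniformly chosen neighbour. -/
noncomputable def lazyStep {V : Type*} (G : SimpleGraph V) (u w : V) : ENNReal :=
  if u = w then 2⁻¹ else if G.Adj u w then 2⁻¹ / ((G.neighborSet u).ncard : ENNReal) else 0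

/-- `μ` is the law of the lazy random walk on `G` started at `v`: its finite-dimensional
distributions are given by the products of the lazy transition probabilities. -/
def IsLazyWalkLaw {V : Type*} [MeasurableSpace V] (G : SimpleGraph V) (v : V)
    (μ : Measure (ℕ → V)) : Prop :=
  ∀ (n : ℕ) (p : Fin (n + 1) → V),
    μ {x | ∀ i : Fin (n + 1), x i = p i} =
      (if p 0 = v then 1 else 0) * ∏ i : Fin n, lazyStep G (p i.castSucc) (p i.succ)

/-- A function `h : V → ℝ` is harmonic on `G` if at every vertex it equals the average of
its values over the neighbours. -/
def IsHarmonic {V : Type*} (G : SimpleGraph V) (h : V → ℝ) : Prop :=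
  ∀ v, h v = (∑ᶠ w ∈ G.neighborSet v, h w) / ((G.neighborSet v).ncard : ℝ)

/-- A graph is Liouville if every bounded harmonic function on it is constant. -/
def LiouvilleGraph {V : Type*} (G : SimpleGraph V) : Prop :=
  ∀ h : V → ℝ, IsHarmonic G h → (∃ C : ℝ, ∀ v, |h v| ≤ C) → ∀ u w, h u = h w

section Paths

variable {V : Type*}

/-- The event that a trajectory agrees with `p` up to and including time `n`. -/
def pathCylinder (p : ℕ → V) (n : ℕ) : Set (ℕ → V) := {x | ∀ i ≤ n, x i = p i}

/-- The time shift on trajectories. -/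
def timeShift (n : ℕ) (x : ℕ → V) : ℕ → V := fun i => x (n + i)

lemma timeShift_surjective [Nonempty V] (n : ℕ) : Function.Surjective (timeShift (V := V) n) := by
  intro y
  refine ⟨fun i => y (i - n), ?_⟩
  ext i
  simp [timeShift]

lemma timeShift_zero : timeShift (V := V) 0 = id := by
  ext x i
  simp [timeShift]

lemma timeShift_comp (m n : ℕ) (x : ℕ → V) :
    timeShift n (timeShift m x) = timeShift (m + n) x := by
  ext i
  simp [timeShift, add_assoc]

lemma pathCylinder_congr {p q : ℕ → V} {n : ℕ} (h : ∀ i ≤ n, p i = q i) :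
    pathCylinder p n = pathCylinder q n := by
  ext x
  exact forall₂_congr fun i hi => by rw [h i hi]

variable [MeasurableSpace V]

lemma measurable_timeShift (n : ℕ) : Measurable (timeShift (V := V) n) :=
  measurable_pi_lambda _ fun _ => measurable_pi_apply _

variable [DiscreteMeasurableSpace V]

lemma measurableSet_pathCylinder (p : ℕ → V) (n : ℕ) : MeasurableSet (pathCylinder p n) := by
  simp only [pathCylinder, Set.ofPred_forall]
  exact MeasurableSet.iInter fun i => MeasurableSet.iInter fun _ =>
    measurable_pi_apply (X := fun _ : ℕ => V) i (MeasurableSet.of_discrete (s := {p i}))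

/-- A trajectory extending a finite path by a constant. -/
def extendPath {n : ℕ} (q : Fin (n + 1) → V) (i : ℕ) : V :=
  if h : i < n + 1 then q ⟨i, h⟩ else q 0

omit [MeasurableSpace V] [DiscreteMeasurableSpace V] in
lemma extendPath_of_le {n : ℕ} (q : Fin (n + 1) → V) {i : ℕ} (hi : i ≤ n) :
    extendPath q i = q ⟨i, by omega⟩ := dif_pos (by omega)

omit [MeasurableSpace V] [DiscreteMeasurableSpace V] in
lemma mem_pathCylinder_extendPath {n : ℕ} {q : Fin (n + 1) → V} {x : ℕ → V} :
    x ∈ pathCylinder (extendPath q) n ↔ ∀ i : Fin (n + 1), x i = q i := by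
  constructor
  · intro h i
    rw [h i (by omega), extendPath_of_le q (by omega)]
  · intro h i hi
    rw [extendPath_of_le q hi]
    exact h ⟨i, by omega⟩

/-- Finite measures on trajectories are determined by their values on path cylinders. -/
lemma ext_of_pathCylinder [Countable V] {μ ν : Measure (ℕ → V)} [IsFiniteMeasure μ]
    (huniv : μ Set.univ = ν Set.univ)
    (h : ∀ p n, μ (pathCylinder p n) = ν (pathCylinder p n)) : μ = ν := by
  refine ext_of_generate_finite {s | ∃ p n, s = pathCylinder p n} (le_antisymm ?_ ?_) ?_ ?_ huniv
  · refine iSup_le fun i => ?_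
    rintro _ ⟨s, -, rfl⟩
    have : (fun f : ℕ → V => f i) ⁻¹' s =
        ⋃ q : {q : Fin (i + 1) → V // q (Fin.last i) ∈ s}, pathCylinder (extendPath q.1) i := by
      ext x
      simp only [Set.mem_preimage, Set.mem_iUnion, mem_pathCylinder_extendPath]
      constructor
      · exact fun hx => ⟨⟨fun j => x j, hx⟩, fun _ => rfl⟩
      · rintro ⟨⟨q, hq⟩, hx⟩
        have := hx (Fin.last i)
        simp only [Fin.val_last] at this
        rwa [this]
    rw [this]
    exact MeasurableSet.iUnion fun q => MeasurableSpace.measurableSet_generateFrom ⟨_, _, rfl⟩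
  · refine MeasurableSpace.generateFrom_le ?_
    rintro _ ⟨p, n, rfl⟩
    exact measurableSet_pathCylinder p n
  · have key : ∀ (p q : ℕ → V) (m n : ℕ), m ≤ n →
        (pathCylinder p m ∩ pathCylinder q n).Nonempty →
        pathCylinder p m ∩ pathCylinder q n = pathCylinder q n := by
      rintro p q m n hmn ⟨x, hp, hq⟩
      refine Set.inter_eq_right.2 fun y hy i hi => ?_
      rw [hy i (hi.trans hmn), ← hq i (hi.trans hmn), hp i hi]
    rintro _ ⟨p, m, rfl⟩ _ ⟨q, n, rfl⟩ hne
    rcases le_total m n with hmn | hmn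
    · exact ⟨q, n, key p q m n hmn hne⟩
    · rw [Set.inter_comm] at hne ⊢
      exact ⟨p, m, key q p n m hmn hne⟩
  · rintro _ ⟨p, n, rfl⟩
    exact h p n

omit [DiscreteMeasurableSpace V] in
lemma cylAlg_Ici_eq_comap_timeShift (n : ℕ) :
    cylAlg V (Set.Ici n) = MeasurableSpace.comap (timeShift n) MeasurableSpace.pi := by
  simp only [cylAlg, MeasurableSpace.pi, MeasurableSpace.comap_iSup, MeasurableSpace.comap_comp]
  apply le_antisymm
  · refine iSup₂_le fun i hi => ?_
    refine le_iSup_of_le (i - n) (le_of_eq ?_)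
    congr 1
    ext x
    simp [timeShift, Nat.add_sub_cancel' hi]
  · refine iSup_le fun i => le_iSup₂_of_le (n + i) (Nat.le_add_right n i) le_rfl

omit [DiscreteMeasurableSpace V] in
/-- A tail event is a shift preimage of a measurable set for every shift. -/
lemma exists_preimage_timeShift_of_tailAlg {S : Set (ℕ → V)} (hS : MeasurableSet[tailAlg V ℕ] S)
    (n : ℕ) : ∃ B, MeasurableSet B ∧ timeShift n ⁻¹' B = S := by
  have hle : tailAlg V ℕ ≤ cylAlg V (Set.Ici n) :=
    iInf₂_le (Set.Ici n) (by rw [Set.compl_Ici]; exact Set.finite_Iio n)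
  have := hle S hS
  rwa [cylAlg_Ici_eq_comap_timeShift] at this

lemma measurable_tailAlg_limsup (h : V → ℝ) :
    Measurable[tailAlg V ℕ] fun x : ℕ → V => limsup (fun n => h (x n)) atTop := by
  intro U hU
  rw [tailAlg, MeasurableSpace.measurableSet_iInf]
  intro J
  rw [MeasurableSpace.measurableSet_iInf]
  intro hJ
  obtain ⟨N, hN⟩ := hJ.bddAbove
  have hmem : ∀ n, n + (N + 1) ∈ J := fun n => by
    by_contra hn
    have := hN hn
    omega
  have hm : Measurable[cylAlg V J] fun x : ℕ → V => limsup (fun n => h (x (n + (N + 1)))) atTop := by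
    refine Measurable.limsup fun n => ?_
    have h1 : @Measurable _ _ (cylAlg V J) _ fun x : ℕ → V => x (n + (N + 1)) := by
      refine Measurable.mono (ma := MeasurableSpace.comap (fun f : ℕ → V => f (n + (N + 1))) _)
        (comap_measurable _) (le_iSup₂_of_le _ (hmem n) le_rfl) le_rfl
    exact (Measurable.of_discrete (f := h)).comp h1
  have heq : (fun x : ℕ → V => limsup (fun n => h (x n)) atTop) =
      fun x : ℕ → V => limsup (fun n => h (x (n + (N + 1)))) atTop := by
    ext x
    exact (limsup_nat_add (fun n => h (x n)) (N + 1)).symm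
  rw [heq]
  exact hm hU

end Paths

lemma SimpleGraph.Connected.countable_of_finite_neighborSet {V : Type*} {G : SimpleGraph V}
    (hconn : G.Connected) (hlf : ∀ v, (G.neighborSet v).Finite) : Countable V := by
  have hlen : ∀ n v, {w | ∃ p : G.Walk v w, p.length = n}.Countable := by
    intro n
    induction n with
    | zero =>
      intro v
      refine (Set.countable_singleton v).mono ?_
      rintro w ⟨p, hp⟩
      exact (p.eq_of_length_eq_zero hp).symm
    | succ n ih =>
      intro v
      refine ((hlf v).countable.biUnion fun u _ => ih u).mono ?_
      rintro w ⟨p, hp⟩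
      cases p with
      | nil => simp at hp
      | cons hadj p => exact Set.mem_biUnion hadj ⟨p, by simpa using hp⟩
  obtain ⟨v⟩ := hconn.nonempty
  refine Set.countable_univ_iff.1 ((Set.countable_iUnion fun n => hlen n v).mono fun w _ => ?_)
  obtain ⟨p⟩ := hconn.preconnected v w
  exact Set.mem_iUnion.2 ⟨p.length, p, rfl⟩

section Law

variable {V : Type*} [MeasurableSpace V] {G : SimpleGraph V} {v : V} {μ : Measure (ℕ → V)}

lemma isLazyWalkLaw_iff : IsLazyWalkLaw G v μ ↔ ∀ (p : ℕ → V) (n : ℕ),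
    μ (pathCylinder p n) =
      (if p 0 = v then 1 else 0) * ∏ i ∈ Finset.range n, lazyStep G (p i) (p (i + 1)) := by
  constructor
  · intro h p n
    have hset : pathCylinder p n = {x | ∀ i : Fin (n + 1), x i = p i} := by
      ext x
      exact ⟨fun hx i => hx i (by omega), fun hx i hi => hx ⟨i, by omega⟩⟩
    rw [hset, h n fun i => p i, Finset.prod_range]
    rfl
  · intro h n q
    have hset : {x | ∀ i : Fin (n + 1), x i = q i} = pathCylinder (extendPath q) n := by
      ext x
      exact mem_pathCylinder_extendPath.symm
    rw [hset, h, extendPath_of_le q (Nat.zero_le n), Finset.prod_range]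
    congr 1
    refine Finset.prod_congr rfl fun i _ => ?_
    rw [extendPath_of_le q i.2.le, extendPath_of_le q (by omega)]
    rfl

variable [DiscreteMeasurableSpace V]

lemma IsLazyWalkLaw.unique [Countable V] {ν : Measure (ℕ → V)} [IsProbabilityMeasure μ]
    [IsProbabilityMeasure ν] (hμ : IsLazyWalkLaw G v μ) (hν : IsLazyWalkLaw G v ν) : μ = ν := by
  refine ext_of_pathCylinder (by simp) fun p n => ?_
  rw [isLazyWalkLaw_iff.1 hμ, isLazyWalkLaw_iff.1 hν]

/-- The Markov property: after conditioning on its first `n` steps, the walk restarts afresh. -/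
lemma IsLazyWalkLaw.restart [IsProbabilityMeasure μ] (hμ : IsLazyWalkLaw G v μ) (p : ℕ → V)
    (n : ℕ) (hp : μ (pathCylinder p n) ≠ 0) :
    IsLazyWalkLaw G (p n) ((ProbabilityTheory.cond μ (pathCylinder p n)).map (timeShift n)) := by
  rw [isLazyWalkLaw_iff]
  intro q m
  rw [Measure.map_apply (measurable_timeShift n) (measurableSet_pathCylinder q m),
    ProbabilityTheory.cond_apply (measurableSet_pathCylinder p n)]
  by_cases hq : q 0 = p n
  · have hset : pathCylinder p n ∩ timeShift n ⁻¹' pathCylinder q m =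
        pathCylinder (fun i => if i ≤ n then p i else q (i - n)) (n + m) := by
      ext x
      constructor
      · rintro ⟨h1, h2⟩ i hi
        dsimp only
        split_ifs with hin
        · exact h1 i hin
        · have := h2 (i - n) (by omega)
          rwa [timeShift, Nat.add_sub_cancel' (by omega)] at this
      · intro h
        refine ⟨fun i hi => by simpa [hi] using h i (by omega), fun i hi => ?_⟩
        have := h (n + i) (by omega)
        dsimp only at this
        rw [timeShift, this]
        split_ifs with hin
        · obtain rfl : i = 0 := by omega
          exact hq.symm
        · congr 1
          omega
    have hprod : μ (pathCylinder (fun i => if i ≤ n then p i else q (i - n)) (n + m)) =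
        μ (pathCylinder p n) * ∏ i ∈ Finset.range m, lazyStep G (q i) (q (i + 1)) := by
      rw [isLazyWalkLaw_iff.1 hμ, isLazyWalkLaw_iff.1 hμ, Finset.prod_range_add, mul_assoc]
      simp only [Nat.zero_le, if_true]
      congr 2
      · refine Finset.prod_congr rfl fun i hi => ?_
        have := Finset.mem_range.1 hi
        rw [if_pos (by omega), if_pos (by omega)]
      · refine Finset.prod_congr rfl fun i hi => ?_
        congr 1
        · split_ifs with hin
          · obtain rfl : i = 0 := by omega
            exact hq.symm
          · congr 1
            omega
        · rw [if_neg (by omega)]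
          congr 1
          omega
    rw [hset, hprod, ← mul_assoc, ENNReal.inv_mul_cancel hp (measure_ne_top _ _), if_pos hq]
  · have hset : pathCylinder p n ∩ timeShift n ⁻¹' pathCylinder q m = ∅ := by
      refine Set.eq_empty_of_forall_notMem ?_
      rintro x ⟨h1, h2⟩
      exact hq (by rw [← h2 0 (Nat.zero_le m), ← h1 n le_rfl]; rfl)
    rw [hset, if_neg hq]
    simp

lemma IsLazyWalkLaw.measure_inter_preimage_timeShift [Countable V] [IsProbabilityMeasure μ]
    (hμ : IsLazyWalkLaw G v μ) (p : ℕ → V) (n : ℕ) {ν : Measure (ℕ → V)}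
    [IsProbabilityMeasure ν] (hν : IsLazyWalkLaw G (p n) ν) {B : Set (ℕ → V)}
    (hB : MeasurableSet B) :
    μ (pathCylinder p n ∩ timeShift n ⁻¹' B) = μ (pathCylinder p n) * ν B := by
  by_cases hp : μ (pathCylinder p n) = 0
  · rw [hp, zero_mul]
    exact measure_mono_null Set.inter_subset_left hp
  · have := ProbabilityTheory.cond_isProbabilityMeasure hp
    have := Measure.isProbabilityMeasure_map (μ := ProbabilityTheory.cond μ (pathCylinder p n))
      (measurable_timeShift n).aemeasurable
    rw [hν.unique (hμ.restart p n hp), Measure.map_apply (measurable_timeShift n) hB,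
      ProbabilityTheory.cond_apply (measurableSet_pathCylinder p n), ← mul_assoc,
      ENNReal.mul_inv_cancel hp (measure_ne_top _ _), one_mul]

end Law

section SpaceTime

variable {V : Type*}

/-- A bounded space-time harmonic function of a lazy chain is nondecreasing in time. -/
lemma le_succ_of_lazy_recursion (Q : (V → ℝ) →ₗ[ℝ] V → ℝ)
    (hQ : ∀ g δ, (∀ u, g u ≤ δ) → ∀ u, Q g u ≤ δ) {f : ℕ → V → ℝ} {K : ℝ}
    (hK : ∀ n u, |f n u| ≤ K)
    (hf : ∀ n u, f n u = 2⁻¹ * f (n + 1) u + 2⁻¹ * Q (f (n + 1)) u) (n : ℕ) (u : V) :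
    f n u ≤ f (n + 1) u := by
  by_contra! hlt
  set g : ℕ → V → ℝ := fun n => f n - f (n + 1) with hg
  have hgrec : ∀ n u, g n u = 2⁻¹ * g (n + 1) u + 2⁻¹ * Q (g (n + 1)) u := by
    intro n u
    simp only [hg, map_sub, Pi.sub_apply]
    rw [hf n u, hf (n + 1) u]
    ring
  have hbdd : BddAbove (Set.range fun a : ℕ × V => g a.1 a.2) := by
    refine ⟨2 * K, ?_⟩
    rintro _ ⟨⟨k, w⟩, rfl⟩
    have h1 := abs_le.1 (hK k w)
    have h2 := abs_le.1 (hK (k + 1) w)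
    simp only [hg, Pi.sub_apply]
    linarith
  set δ := sSup (Set.range fun a : ℕ × V => g a.1 a.2)
  have hle : ∀ n u, g n u ≤ δ := fun n u => le_csSup hbdd ⟨(n, u), rfl⟩
  have hδ : 0 < δ := lt_of_lt_of_le (by simpa [hg] using hlt) (hle n u)
  obtain ⟨m, hm⟩ := exists_nat_gt (2 * K / (δ / 2))
  rw [div_lt_iff₀ (by positivity)] at hm
  set ε := δ / 2 / 2 ^ m with hε
  have hεpos : 0 < ε := by positivity
  obtain ⟨_, ⟨⟨k, w⟩, rfl⟩, hkw⟩ := exists_lt_of_lt_csSup (⟨_, (n, u), rfl⟩ :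
    (Set.range fun a : ℕ × V => g a.1 a.2).Nonempty) (sub_lt_self δ hεpos)
  have hlow : ∀ j, δ - 2 ^ j * ε ≤ g (k + j) w := by
    intro j
    induction j with
    | zero => simpa using hkw.le
    | succ j ih =>
      have h1 := hgrec (k + j) w
      have h2 := hQ _ δ (hle (k + j + 1)) w
      rw [← add_assoc, pow_succ]
      linarith
  have hsum : ∑ j ∈ Finset.range m, g (k + j) w = f k w - f (k + m) w :=
    Finset.sum_range_sub' (fun j => f (k + j) w) m
  have hsum_ge : m * (δ / 2) ≤ ∑ j ∈ Finset.range m, g (k + j) w := by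
    rw [← nsmul_eq_mul, ← Finset.card_range m, ← Finset.sum_const, Finset.card_range]
    refine Finset.sum_le_sum fun j hj => le_trans ?_ (hlow j)
    have : (2 : ℝ) ^ j * ε ≤ 2 ^ m * ε := by
      gcongr
      · norm_num
      · exact (Finset.mem_range.1 hj).le
    have h3 : (2 : ℝ) ^ m * ε = δ / 2 := by
      rw [hε]
      field_simp
    linarith
  have h1 := abs_le.1 (hK k w)
  have h2 := abs_le.1 (hK (k + m) w)
  linarith

lemma eq_succ_of_lazy_recursion (Q : (V → ℝ) →ₗ[ℝ] V → ℝ)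
    (hQ : ∀ g δ, (∀ u, g u ≤ δ) → ∀ u, Q g u ≤ δ) {f : ℕ → V → ℝ} {K : ℝ}
    (hK : ∀ n u, |f n u| ≤ K)
    (hf : ∀ n u, f n u = 2⁻¹ * f (n + 1) u + 2⁻¹ * Q (f (n + 1)) u) (n : ℕ) :
    f n = f (n + 1) := by
  ext u
  refine le_antisymm (le_succ_of_lazy_recursion Q hQ hK hf n u) ?_
  have := le_succ_of_lazy_recursion Q hQ (f := fun n => -f n) (K := K) (by simpa using hK)
    (fun n u => by
      simp only [map_neg, Pi.neg_apply]
      rw [hf n u]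
      ring) n u
  simpa using this

/-- The operator averaging a function over the neighbours of each vertex. -/
noncomputable def neighborAverage (G : SimpleGraph V) (hlf : ∀ v, (G.neighborSet v).Finite) :
    (V → ℝ) →ₗ[ℝ] V → ℝ where
  toFun g u := (∑ w ∈ (hlf u).toFinset, g w) / (G.neighborSet u).ncard
  map_add' g₁ g₂ := by
    ext u
    simp [Finset.sum_add_distrib, add_div]
  map_smul' c g := by
    ext u
    simp [← Finset.mul_sum, mul_div_assoc]

lemma isHarmonic_iff_neighborAverage_eq {G : SimpleGraph V}
    (hlf : ∀ v, (G.neighborSet v).Finite) {h : V → ℝ} :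
    IsHarmonic G h ↔ neighborAverage G hlf h = h := by
  rw [funext_iff]
  refine forall_congr' fun u => ?_
  rw [finsum_mem_eq_finite_toFinset_sum _ (hlf u), eq_comm]
  rfl

lemma SimpleGraph.Connected.ncard_neighborSet_pos [Nontrivial V] {G : SimpleGraph V}
    (hconn : G.Connected) (hlf : ∀ v, (G.neighborSet v).Finite) (u : V) :
    0 < (G.neighborSet u).ncard := by
  rw [Set.ncard_pos (hlf u)]
  exact hconn.preconnected.exists_adj_of_nontrivial u

lemma neighborAverage_le {G : SimpleGraph V} (hlf : ∀ v, (G.neighborSet v).Finite)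
    (hpos : ∀ u, 0 < (G.neighborSet u).ncard) (g : V → ℝ) (δ : ℝ) (hg : ∀ u, g u ≤ δ) (u : V) :
    neighborAverage G hlf g u ≤ δ := by
  have := hpos u
  change (∑ w ∈ (hlf u).toFinset, g w) / ((G.neighborSet u).ncard : ℝ) ≤ δ
  rw [div_le_iff₀ (by exact_mod_cast this), Set.ncard_eq_toFinset_card _ (hlf u), mul_comm,
    ← nsmul_eq_mul]
  exact Finset.sum_le_card_nsmul _ _ _ fun w _ => hg w

end SpaceTime

section Step

variable {V : Type*} [MeasurableSpace V] {G : SimpleGraph V}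

/-- The law of one step of the lazy random walk from `u`. -/
noncomputable def lazyStepMeasure (G : SimpleGraph V) (hlf : ∀ v, (G.neighborSet v).Finite)
    (u : V) : Measure V :=
  (2⁻¹ : ENNReal) • Measure.dirac u +
    ∑ w ∈ (hlf u).toFinset, (2⁻¹ / ((G.neighborSet u).ncard : ENNReal)) • Measure.dirac w

variable [DiscreteMeasurableSpace V] (hlf : ∀ v, (G.neighborSet v).Finite)

lemma lazyStepMeasure_singleton (u w : V) : lazyStepMeasure G hlf u {w} = lazyStep G u w := by
  simp only [lazyStepMeasure, Measure.add_apply, Measure.smul_apply, Measure.finsetSum_apply,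
    Measure.dirac_apply, smul_eq_mul, Set.indicator_apply, Set.mem_singleton_iff, Pi.one_apply,
    mul_ite, mul_one, mul_zero, Finset.sum_ite_eq', lazyStep, Set.Finite.mem_toFinset,
    SimpleGraph.mem_neighborSet]
  by_cases huw : u = w
  · subst huw
    simp
  · simp [huw]

lemma integral_lazyStepMeasure {u : V} (hpos : 0 < (G.neighborSet u).ncard) {g : V → ℝ} :
    ∫ w, g w ∂lazyStepMeasure G hlf u = 2⁻¹ * g u + 2⁻¹ * neighborAverage G hlf g u := by
  have hg : ∀ w, Integrable g (Measure.dirac w) := fun w =>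
    integrable_dirac (by simp)
  have hc : 2⁻¹ / ((G.neighborSet u).ncard : ENNReal) ≠ ⊤ :=
    ENNReal.div_ne_top (by simp) (by exact_mod_cast hpos.ne')
  rw [lazyStepMeasure, integral_add_measure ((hg u).smul_measure (by simp))
    (integrable_finsetSum_measure.2 fun w _ => (hg w).smul_measure hc),
    integral_finsetSum_measure fun w _ => (hg w).smul_measure hc]
  simp only [integral_smul_measure, integral_dirac, smul_eq_mul, neighborAverage,
    LinearMap.coe_mk, AddHom.coe_mk, ← Finset.mul_sum]
  simp
  ring

end Step

section Walk

variable {V : Type*} [MeasurableSpace V] [DiscreteMeasurableSpace V] {G : SimpleGraph V} {v : V}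
  {μ : Measure (ℕ → V)}

lemma IsLazyWalkLaw.ae_zero_eq [IsProbabilityMeasure μ] (hμ : IsLazyWalkLaw G v μ) : ∀ᵐ x ∂μ, x 0 = v := by
  have h : μ (pathCylinder (fun _ => v) 0) = 1 := by
    rw [isLazyWalkLaw_iff.1 hμ]
    simp
  filter_upwards [(mem_ae_iff_prob_eq_one (measurableSet_pathCylinder _ _)).2 h] with x hx
  exact hx 0 le_rfl

omit [DiscreteMeasurableSpace V] in
/-- Every vertex is visited with positive probability. -/
lemma IsLazyWalkLaw.exists_pathCylinder_ne_zero (hμ : IsLazyWalkLaw G v μ) (hconn : G.Connected)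
    (w : V) : ∃ p n, p n = w ∧ μ (pathCylinder p n) ≠ 0 := by
  obtain ⟨q⟩ := hconn.preconnected v w
  refine ⟨q.getVert, q.length, q.getVert_length, ?_⟩
  rw [isLazyWalkLaw_iff.1 hμ, if_pos q.getVert_zero, one_mul]
  refine Finset.prod_ne_zero_iff.2 fun i hi => ?_
  have hadj := q.adj_getVert_succ (Finset.mem_range.1 hi)
  rw [lazyStep, if_neg hadj.ne, if_pos hadj]
  simp

lemma IsLazyWalkLaw.exists_law [IsProbabilityMeasure μ] (hμ : IsLazyWalkLaw G v μ)
    (hconn : G.Connected) (w : V) :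
    ∃ ν : Measure (ℕ → V), IsProbabilityMeasure ν ∧ IsLazyWalkLaw G w ν := by
  obtain ⟨p, n, rfl, hp⟩ := hμ.exists_pathCylinder_ne_zero hconn w
  have := ProbabilityTheory.cond_isProbabilityMeasure hp
  exact ⟨_, Measure.isProbabilityMeasure_map (measurable_timeShift n).aemeasurable,
    hμ.restart p n hp⟩

/-- First step decomposition of the probability of a shifted event. -/
lemma IsLazyWalkLaw.measureReal_preimage_timeShift_one [Countable V] [IsProbabilityMeasure μ]
    (hμ : IsLazyWalkLaw G v μ) (hlf : ∀ v, (G.neighborSet v).Finite)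
    (hpos : 0 < (G.neighborSet v).ncard) {P : V → Measure (ℕ → V)}
    [∀ w, IsProbabilityMeasure (P w)] (hP : ∀ w, IsLazyWalkLaw G w (P w)) {B : Set (ℕ → V)}
    (hB : MeasurableSet B) :
    μ.real (timeShift 1 ⁻¹' B) = 2⁻¹ * (P v).real B +
      2⁻¹ * neighborAverage G hlf (fun w => (P w).real B) v := by
  have hsum : μ (timeShift 1 ⁻¹' B) = ∑' w, lazyStep G v w * P w B := by
    have hT : MeasurableSet (timeShift 1 ⁻¹' B) := measurable_timeShift 1 hB
    have hset : timeShift 1 ⁻¹' B =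
        ⋃ w, {x : ℕ → V | x 1 = w} ∩ timeShift 1 ⁻¹' B := by
      ext x
      simp
    rw [hset, measure_iUnion]
    · refine tsum_congr fun w => ?_
      have hcyl : μ (pathCylinder (fun i => if i = 0 then v else w) 1) = lazyStep G v w := by
        rw [isLazyWalkLaw_iff.1 hμ]
        simp
      have hmarkov := hμ.measure_inter_preimage_timeShift (fun i => if i = 0 then v else w) 1
        (hP w) hB
      rw [hcyl] at hmarkov
      rw [← hmarkov]
      refine measure_congr ?_
      filter_upwards [hμ.ae_zero_eq] with x hx
      refine propext (and_congr_left fun _ => ?_)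
      constructor
      · intro h1 i hi
        interval_cases i
        · simpa using hx
        · simpa using h1
      · intro h
        simpa using h 1 le_rfl
    · intro w w' hww'
      rw [Function.onFun, Set.disjoint_left]
      rintro x ⟨h1, -⟩ ⟨h2, -⟩
      exact hww' (h1.symm.trans h2)
    · exact fun w => (measurable_pi_apply (X := fun _ : ℕ => V) 1
        (MeasurableSet.of_discrete (s := {w}))).inter hT
  refine Eq.trans ?_ (integral_lazyStepMeasure hlf hpos (g := fun w => (P w).real B))
  change _ = ∫ w, (P w B).toReal ∂lazyStepMeasure G hlf v
  rw [integral_toReal Measurable.of_discrete.aemeasurable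
    (Eventually.of_forall fun w => measure_lt_top _ _), lintegral_countable', Measure.real, hsum]
  simp only [lazyStepMeasure_singleton, mul_comm]

end Walk

section HarmonicMartingale

variable {V : Type*} [MeasurableSpace V] [DiscreteMeasurableSpace V] {G : SimpleGraph V} {v : V}
  {μ : Measure (ℕ → V)}

lemma integrable_comp_eval [IsFiniteMeasure μ] {h : V → ℝ} {C : ℝ} (hC : ∀ v, |h v| ≤ C) (n : ℕ) :
    Integrable (fun x : ℕ → V => h (x n)) μ :=
  Integrable.of_bound (Measurable.of_discrete.comp (measurable_pi_apply n)).aestronglyMeasurable C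
    (Eventually.of_forall fun x => hC (x n))

lemma setIntegral_pathCylinder (h : V → ℝ) (p : ℕ → V) (n : ℕ) :
    ∫ x in pathCylinder p n, h (x n) ∂μ = μ.real (pathCylinder p n) * h (p n) := by
  rw [setIntegral_congr_fun (g := fun _ => h (p n)) (measurableSet_pathCylinder p n)
    fun x hx => by simp only [hx n le_rfl], setIntegral_const, smul_eq_mul]

lemma IsLazyWalkLaw.setIntegral_pathCylinder_succ [Countable V] [IsProbabilityMeasure μ]
    (hμ : IsLazyWalkLaw G v μ) (hlf : ∀ v, (G.neighborSet v).Finite)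
    (hpos : ∀ u, 0 < (G.neighborSet u).ncard) {h : V → ℝ} (hh : IsHarmonic G h)
    (p : ℕ → V) (n : ℕ) :
    ∫ x in pathCylinder p n, h (x (n + 1)) ∂μ = μ.real (pathCylinder p n) * h (p n) := by
  have heval : Measurable fun x : ℕ → V => x (n + 1) := measurable_pi_apply _
  have hlaw : (μ.restrict (pathCylinder p n)).map (fun x => x (n + 1)) =
      μ (pathCylinder p n) • lazyStepMeasure G hlf (p n) := by
    refine Measure.ext_of_singleton fun w => ?_
    have hset : (fun x : ℕ → V => x (n + 1)) ⁻¹' {w} ∩ pathCylinder p n =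
        pathCylinder (fun i => if i ≤ n then p i else w) (n + 1) := by
      ext x
      constructor
      · rintro ⟨h1, h2⟩ i hi
        dsimp only
        split_ifs with hin
        · exact h2 i hin
        · obtain rfl : i = n + 1 := by omega
          exact h1
      · intro hx
        refine ⟨by simpa using hx (n + 1) le_rfl, fun i hi => ?_⟩
        simpa [hi] using hx i (by omega)
    rw [Measure.map_apply heval MeasurableSet.of_discrete,
      Measure.restrict_apply (heval MeasurableSet.of_discrete), hset, Measure.smul_apply,
      lazyStepMeasure_singleton, isLazyWalkLaw_iff.1 hμ, isLazyWalkLaw_iff.1 hμ,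
      Finset.prod_range_succ, smul_eq_mul, ← mul_assoc]
    simp only [Nat.zero_le, if_true, le_refl, Nat.not_succ_le_self, if_false]
    congr 2
    refine Finset.prod_congr rfl fun i hi => ?_
    have := Finset.mem_range.1 hi
    rw [if_pos (by omega), if_pos (by omega)]
  rw [← integral_map (f := h) heval.aemeasurable Measurable.of_discrete.aestronglyMeasurable, hlaw,
    integral_smul_measure, integral_lazyStepMeasure hlf (hpos _),
    (isHarmonic_iff_neighborAverage_eq hlf).1 hh, smul_eq_mul, Measure.real]
  ring

/-- Harmonic functions turn the lazy random walk into a martingale. -/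
lemma IsLazyWalkLaw.martingale [Countable V] [IsProbabilityMeasure μ]
    (hμ : IsLazyWalkLaw G v μ) (hlf : ∀ v, (G.neighborSet v).Finite)
    (hpos : ∀ u, 0 < (G.neighborSet u).ncard) {h : V → ℝ} (hh : IsHarmonic G h) {C : ℝ}
    (hC : ∀ v, |h v| ≤ C) :
    Martingale (fun n (x : ℕ → V) => h (x n)) (Filtration.piLE (X := fun _ : ℕ => V)) μ := by
  refine martingale_of_setIntegral_eq_succ (fun n => ?_) (integrable_comp_eval hC) fun n s hs => ?_
  · refine Measurable.stronglyMeasurable ?_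
    refine (Measurable.of_discrete (f := h)).comp ?_
    exact (measurable_pi_apply (X := fun _ : Set.Iic n => V) ⟨n, Set.mem_Iic.2 le_rfl⟩).comp
      (comap_measurable (Preorder.restrictLe (π := fun _ : ℕ => V) n))
  · have hmeas := Filtration.le _ n s hs
    obtain ⟨T, -, rfl⟩ := hs
    set s := Preorder.restrictLe (π := fun _ : ℕ => V) n ⁻¹' T
    have hset : s = ⋃ q : {q : Fin (n + 1) → V // ∃ y ∈ s, ∀ j : Fin (n + 1), y j = q j},
        pathCylinder (extendPath q.1) n := by
      ext x
      simp only [Set.mem_iUnion, mem_pathCylinder_extendPath]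
      constructor
      · exact fun hx => ⟨⟨fun j => x j, x, hx, fun _ => rfl⟩, fun _ => rfl⟩
      · rintro ⟨⟨q, y, hy, hyq⟩, hxq⟩
        have : Preorder.restrictLe (π := fun _ : ℕ => V) n x = Preorder.restrictLe n y := by
          ext ⟨j, hj⟩
          have hj' : j < n + 1 := Nat.lt_succ_of_le hj
          exact (hxq ⟨j, hj'⟩).trans (hyq ⟨j, hj'⟩).symm
        change Preorder.restrictLe n x ∈ T
        rw [this]
        exact hy
    have hdisj : Pairwise (Function.onFun Disjoint
        fun q : {q : Fin (n + 1) → V // ∃ y ∈ s, ∀ j : Fin (n + 1), y j = q j} =>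
          pathCylinder (extendPath q.1) n) := by
      intro q q' hne
      rw [Function.onFun, Set.disjoint_left]
      intro x hx hx'
      rw [mem_pathCylinder_extendPath] at hx hx'
      exact hne (Subtype.ext (funext fun j => (hx j).symm.trans (hx' j)))
    rw [hset, integral_iUnion (fun _ => measurableSet_pathCylinder _ _) hdisj
        (integrable_comp_eval hC n).integrableOn,
      integral_iUnion (fun _ => measurableSet_pathCylinder _ _) hdisj
        (integrable_comp_eval hC (n + 1)).integrableOn]
    refine tsum_congr fun q => ?_
    rw [hμ.setIntegral_pathCylinder_succ hlf hpos hh, setIntegral_pathCylinder]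

end HarmonicMartingale

section ZeroOne

variable {V : Type*} [MeasurableSpace V] [DiscreteMeasurableSpace V] {G : SimpleGraph V} {v : V}
  {μ : Measure (ℕ → V)}

omit [DiscreteMeasurableSpace V] in
lemma tailAlg_le_pi : tailAlg V ℕ ≤ MeasurableSpace.pi :=
  iInf₂_le_of_le Set.univ (by simp) (iSup₂_le fun i _ => (measurable_pi_apply i).comap_le)

/-- A tail-trivial lazy random walk lives on a Liouville graph. -/
lemma IsLazyWalkLaw.liouvilleGraph [Countable V] [IsProbabilityMeasure μ]
    (hμ : IsLazyWalkLaw G v μ) (hconn : G.Connected) (hlf : ∀ v, (G.neighborSet v).Finite)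
    (hpos : ∀ u, 0 < (G.neighborSet u).ncard)
    (htriv : ∀ S : Set (ℕ → V), MeasurableSet[tailAlg V ℕ] S → μ S = 0 ∨ μ S = 1) :
    LiouvilleGraph G := by
  rintro h hh ⟨C, hC⟩
  have hmart := hμ.martingale hlf hpos hh hC
  have hlim := hmart.submartingale.ae_tendsto_limitProcess (R := C.toNNReal) fun n => by
    refine (eLpNorm_le_of_ae_bound (Eventually.of_forall fun x => hC (x n))).trans ?_
    simp [ENNReal.ofReal]
  obtain ⟨c, hc⟩ : ∃ c, (fun x : ℕ → V => limsup (fun n => h (x n)) atTop) =ᵐ[μ]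
      Function.const _ c := by
    refine exists_eventuallyEq_const_of_forall_separating MeasurableSet fun U hU => ?_
    have hS := measurable_tailAlg_limsup h hU
    rcases htriv _ hS with h0 | h1
    · exact Or.inr (measure_eq_zero_iff_ae_notMem.1 h0)
    · exact Or.inl ((mem_ae_iff_prob_eq_one (tailAlg_le_pi _ hS)).2 h1)
  have hconv : ∀ᵐ x ∂μ, Tendsto (fun n => h (x n)) atTop (nhds c) := by
    filter_upwards [hlim, hc] with x hx hxc
    have := hx.limsup_eq
    rw [Function.const_apply] at hxc
    rwa [← this, hxc] at hx
  suffices ∀ w, h w = c from fun u w => (this u).trans (this w).symm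
  intro w
  obtain ⟨p, n, rfl, hp⟩ := hμ.exists_pathCylinder_ne_zero hconn w
  have hconst : ∀ m, ∫ x in pathCylinder p n, h (x (n + m)) ∂μ =
      μ.real (pathCylinder p n) * h (p n) := by
    intro m
    rw [← setIntegral_pathCylinder]
    refine (hmart.setIntegral_eq (Nat.le_add_right n m) ?_).symm
    refine ⟨{y | ∀ j : Set.Iic n, y j = p j}, ?_, ?_⟩
    · rw [Set.ofPred_forall]
      exact MeasurableSet.iInter fun j =>
        measurable_pi_apply (X := fun _ : Set.Iic n => V) j (MeasurableSet.of_discrete (s := {p j}))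
    · ext x
      exact ⟨fun hx i hi => hx ⟨i, hi⟩, fun hx i => hx i i.2⟩
  have htend : Tendsto (fun m => ∫ x in pathCylinder p n, h (x (n + m)) ∂μ) atTop
      (nhds (∫ _ in pathCylinder p n, c ∂μ)) := by
    refine tendsto_integral_of_dominated_convergence (fun _ => C)
      (fun m => (integrable_comp_eval hC (n + m)).aestronglyMeasurable) (integrable_const C)
      (fun m => Eventually.of_forall fun x => hC _) (ae_restrict_of_ae ?_)
    filter_upwards [hconv] with x hx
    simpa only [add_comm n, Function.comp_def] using hx.comp (tendsto_add_atTop_nat n)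
  simp only [hconst, setIntegral_const, smul_eq_mul] at htend
  exact mul_left_cancel₀ ((measureReal_ne_zero_iff (measure_ne_top _ _)).2 hp)
    (tendsto_nhds_unique tendsto_const_nhds htend)

/-- The lazy random walk on a Liouville graph is tail-trivial. -/
lemma IsLazyWalkLaw.measure_eq_zero_or_one_of_liouvilleGraph [Countable V]
    [IsProbabilityMeasure μ] (hμ : IsLazyWalkLaw G v μ) (hconn : G.Connected)
    (hlf : ∀ v, (G.neighborSet v).Finite) (hpos : ∀ u, 0 < (G.neighborSet u).ncard)
    (hG : LiouvilleGraph G) {S : Set (ℕ → V)} (hS : MeasurableSet[tailAlg V ℕ] S) :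
    μ S = 0 ∨ μ S = 1 := by
  choose P hprob hP using hμ.exists_law hconn
  choose B hB hBS using exists_preimage_timeShift_of_tailAlg hS
  have : Nonempty V := ⟨v⟩
  have hBsucc : ∀ n, B n = timeShift 1 ⁻¹' B (n + 1) := by
    refine fun n => (timeShift_surjective n).preimage_injective ?_
    rw [hBS n, ← hBS (n + 1)]
    ext x
    simp [timeShift_comp]
  set f : ℕ → V → ℝ := fun n w => (P w).real (B n)
  have hrec : ∀ n u, f n u = 2⁻¹ * f (n + 1) u + 2⁻¹ * neighborAverage G hlf (f (n + 1)) u := by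
    intro n u
    change (P u).real (B n) = _
    rw [hBsucc n, (hP u).measureReal_preimage_timeShift_one hlf (hpos u) hP (hB (n + 1))]
  have hbdd : ∀ n u, |f n u| ≤ 1 := fun n u => by
    rw [abs_of_nonneg measureReal_nonneg]
    exact measureReal_le_one
  have hstep := eq_succ_of_lazy_recursion _ (neighborAverage_le hlf hpos) hbdd hrec
  have hf0 : ∀ n, f n = f 0 := fun n => by
    induction n with
    | zero => rfl
    | succ n ih => rw [← hstep n, ih]
  have hharm : IsHarmonic G (f 0) := by
    rw [isHarmonic_iff_neighborAverage_eq hlf]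
    ext u
    have := hrec 0 u
    rw [← hstep 0] at this
    linarith
  have hconst := hG (f 0) hharm ⟨1, hbdd 0⟩
  have hPB : ∀ n w, P w (B n) = μ S := by
    intro n w
    have h0 : μ S = P v (B 0) := by
      rw [hμ.unique (hP v), ← hBS 0, timeShift_zero, Set.preimage_id]
    rw [h0, ← measureReal_eq_measureReal_iff]
    change f n w = f 0 v
    rw [hf0 n, hconst w v]
  have hmeas : MeasurableSet S := tailAlg_le_pi _ hS
  have hindep : μ.restrict S = μ S • μ := by
    refine ext_of_pathCylinder (by simp) fun p n => ?_
    rw [Measure.restrict_apply (measurableSet_pathCylinder p n), Measure.smul_apply, smul_eq_mul,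
      ← hPB n (p n), mul_comm, ← hμ.measure_inter_preimage_timeShift p n (hP _) (hB n), hBS]
  have hsq : μ S = μ S * μ S := by
    simpa [Measure.restrict_apply hmeas] using congrArg (fun ν : Measure (ℕ → V) => ν S) hindep
  rcases eq_or_ne (μ S) 0 with h0 | h0
  · exact Or.inl h0
  · exact Or.inr ((ENNReal.mul_eq_left h0 (measure_ne_top _ _)).1 hsq.symm)

end ZeroOne

theorem stmt5 {V : Type*} [MeasurableSpace V] [DiscreteMeasurableSpace V] [Infinite V]
    (G : SimpleGraph V) (hconn : G.Connected) (hlf : ∀ v, (G.neighborSet v).Finite)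
    (v : V) (μ : Measure (ℕ → V)) [IsProbabilityMeasure μ] (hμ : IsLazyWalkLaw G v μ) :
    LiouvilleGraph G ↔
      ∀ S : Set (ℕ → V), MeasurableSet[tailAlg V ℕ] S → μ S = 0 ∨ μ S = 1 := by
  have := hconn.countable_of_finite_neighborSet hlf
  have hpos := hconn.ncard_neighborSet_pos hlf
  exact ⟨fun hG _ hS => hμ.measure_eq_zero_or_one_of_liouvilleGraph hconn hlf hpos hG hS,
    hμ.liouvilleGraph hconn hlf hpos⟩
end

section
/- Let G = (V, E) be an infinite, connected, locally finite, one-ended simple graph. Let F ⊆ E be a set of edges such that every connected component of the spanning subgraph (V, F) is infinite, and let B ⊆ E be a finite set of edges with B ∩ F = ∅. Then the graph (V, E ∖ B) obtained from G by deleting the edges in B is connected. -/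
/-- An infinite graph is one-ended if deleting any finite set of vertices results in at
most one infinite connected component. -/
def OneEnded {V : Type*} (G : SimpleGraph V) : Prop :=
  ∀ K : Set V, K.Finite →
    ∀ c d : (G.induce Kᶜ).ConnectedComponent, c.supp.Infinite → d.supp.Infinite → c = d

/-- A walk from outside `K` to a vertex of `K` passes, before entering `K`, through a neighbour
of `K`. -/
theorem exists_reachable_adj_of_walk {V : Type*} {G : SimpleGraph V} {K : Set V} {w k : V}
    (p : G.Walk w k) (hk : k ∈ K) (hw : w ∈ Kᶜ) :
    ∃ s : ↥Kᶜ, (∃ x ∈ K, G.Adj x s) ∧ (G.induce Kᶜ).Reachable ⟨w, hw⟩ s := by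
  induction p with
  | nil => exact absurd hk hw
  | @cons a b c hab p ih =>
    by_cases hb : b ∈ K
    · exact ⟨⟨a, hw⟩, ⟨b, hb, hab.symm⟩, .refl _⟩
    · obtain ⟨s, hs, hr⟩ := ih hk hb
      have hadj : (G.induce Kᶜ).Adj ⟨a, hw⟩ ⟨b, hb⟩ := hab
      exact ⟨s, hs, hadj.reachable.trans hr⟩

/-- In a connected locally finite graph, every infinite vertex set meets an infinite component
of the complement of a given nonempty finite set. -/
theorem exists_mem_infinite_component_compl {V : Type*} {G : SimpleGraph V}
    (hconn : G.Connected) (hlf : ∀ v, (G.neighborSet v).Finite) {K : Set V} (hK : K.Finite)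
    (hne : K.Nonempty) {C : Set V} (hC : C.Infinite) :
    ∃ w : ↥Kᶜ, (w : V) ∈ C ∧ ((G.induce Kᶜ).connectedComponentMk w).supp.Infinite := by
  by_contra! h
  obtain ⟨k, hk⟩ := hne
  have hN : (⋃ x ∈ K, G.neighborSet x).Finite := hK.biUnion fun x _ => hlf x
  let S : Set ↥Kᶜ := {s | (∃ x ∈ K, G.Adj x s) ∧
    ((G.induce Kᶜ).connectedComponentMk s).supp.Finite}
  have hS : S.Finite := by
    refine (hN.preimage Subtype.val_injective.injOn).subset ?_
    rintro s ⟨⟨x, hx, hxs⟩, -⟩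
    exact Set.mem_biUnion hx hxs
  have hU : (⋃ s ∈ S, Subtype.val '' ((G.induce Kᶜ).connectedComponentMk s).supp).Finite :=
    hS.biUnion fun s hs => hs.2.image _
  refine hC.sdiff hK (hU.subset ?_)
  rintro w ⟨hwC, hwK⟩
  obtain ⟨p⟩ := hconn.preconnected w k
  obtain ⟨s, hs, hr⟩ := exists_reachable_adj_of_walk p hk hwK
  have heq := SimpleGraph.ConnectedComponent.sound hr
  have hfin := Set.not_infinite.mp (fun hi => hi (h ⟨w, hwK⟩ hwC))
  exact Set.mem_biUnion (x := s) ⟨hs, heq ▸ hfin⟩ ⟨⟨w, hwK⟩, heq, rfl⟩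

theorem stmt9 {V : Type*} [Infinite V] (G : SimpleGraph V)
    (hconn : G.Connected) (hlf : ∀ v, (G.neighborSet v).Finite) (hone : OneEnded G)
    (F : Set (Sym2 V)) (hF : F ⊆ G.edgeSet)
    (hFinf : ∀ v : V, {u : V | (SimpleGraph.fromEdgeSet F).Reachable v u}.Infinite)
    (B : Set (Sym2 V)) (hBE : B ⊆ G.edgeSet) (hBfin : B.Finite) (hBF : B ∩ F = ∅) :
    (G.deleteEdges B).Connected := by
  rcases B.eq_empty_or_nonempty with rfl | ⟨e₀, he₀⟩
  · simpa using hconn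
  let K : Set V := ⋃ e ∈ B, {v | v ∈ e}
  have hK : K.Finite := hBfin.biUnion fun e _ => by
    induction e with
    | h a b => exact (Set.toFinite {a, b}).subset fun v hv => by simpa using hv
  have hne : K.Nonempty := ⟨_, Set.mem_biUnion he₀ (Sym2.out_fst_mem e₀)⟩
  have hFle : SimpleGraph.fromEdgeSet F ≤ G.deleteEdges B := by
    intro a b hab
    rw [SimpleGraph.fromEdgeSet_adj] at hab
    rw [SimpleGraph.deleteEdges_adj]
    exact ⟨hF hab.1, fun hB => Set.eq_empty_iff_forall_notMem.mp hBF _ ⟨hB, hab.1⟩⟩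
  let φ : G.induce Kᶜ →g G.deleteEdges B :=
    { toFun := Subtype.val
      map_rel' := by
        intro a b hab
        rw [SimpleGraph.deleteEdges_adj]
        exact ⟨hab, fun hB => a.2 (Set.mem_biUnion hB (Sym2.mem_mk_left _ _))⟩ }
  have := hconn.nonempty
  refine ⟨fun u v => ?_⟩
  obtain ⟨u', hu, hui⟩ := exists_mem_infinite_component_compl hconn hlf hK hne (hFinf u)
  obtain ⟨v', hv, hvi⟩ := exists_mem_infinite_component_compl hconn hlf hK hne (hFinf v)
  have huv := SimpleGraph.ConnectedComponent.exact (hone K hK _ _ hui hvi)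
  exact ((hu.mono hFle).trans (huv.map φ)).trans (hv.mono hFle).symm
end
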